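/- Let F_q be a finite field with q elements, P the monic irreducibles in F_q[t], and L(m) = Σ_{l∈P}|l|^{-m}. As n → ∞, Σ over pairs of distinct monic irreducibles l ≠ h with deg(l²h) ≤ n of 1/(|l|²|h|) equals L(2) log n + A₁ L(2) - L(3) + O(1/n), where A₁ = γ + Σ_{r≥1}(π_q(r)-q^r/r)q^{-r}. -/

import Mathlib

open Filter Asymptotics Real Polynomial

/-- number of monic irreducible polynomials of degree r in F[t] -/
noncomputable def piq (F : Type*) [Field F] [Fintype F] (r : ℕ) : ℕ :=
  Nat.card {l : Polynomial F // l.Monic ∧ Irreducible l ∧ l.natDegree = r}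

/-- the constant A₁ = γ + Σ_{r≥1} (π_q(r) - q^r/r) q^{-r} -/
noncomputable def A1 (F : Type*) [Field F] [Fintype F] : ℝ :=
  Real.eulerMascheroniConstant +
    ∑' r : ℕ, if r = 0 then 0 else
      ((piq F r : ℝ) - (Fintype.card F : ℝ) ^ r / r) * ((Fintype.card F : ℝ) ^ r)⁻¹

/-- L(m) = Σ_{l ∈ P} |l|^{-m} -/
noncomputable def Lc (F : Type*) [Field F] [Fintype F] (m : ℕ) : ℝ :=
  ∑' l : {l : Polynomial F // l.Monic ∧ Irreducible l},
    (((Fintype.card F : ℝ) ^ (l : Polynomial F).natDegree) ^ m)⁻¹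

/-- ω_k(f): the number of distinct monic irreducible factors of f with multiplicity exactly k -/
noncomputable def omegak (F : Type*) [Field F] [Fintype F] (k : ℕ) (f : Polynomial F) : ℕ :=
  Nat.card {l : Polynomial F // l.Monic ∧ Irreducible l ∧ l ^ k ∣ f ∧ ¬ l ^ (k + 1) ∣ f}


lemma S2.finite_le (F : Type*) [Field F] [Fintype F] (n : ℕ) :
    {l : Polynomial F | l.Monic ∧ Irreducible l ∧ l.natDegree ≤ n}.Finite := by
  have h : Finite (Polynomial.degreeLT F (n + 1)) :=
    Finite.of_equiv _ (Polynomial.degreeLTEquiv F (n + 1)).symm.toEquiv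
  have h2 : ((Polynomial.degreeLT F (n + 1) : Set (Polynomial F))).Finite := h
  refine h2.subset ?_
  rintro l ⟨h1, _, h3⟩
  simp only [SetLike.mem_coe, Polynomial.mem_degreeLT]
  rw [Polynomial.degree_eq_natDegree h1.ne_zero]
  exact_mod_cast Nat.lt_succ_of_le h3

/-- monic irreducibles of degree at most n -/
noncomputable def S2.PF (F : Type*) [Field F] [Fintype F] (n : ℕ) : Finset (Polynomial F) :=
  (S2.finite_le F n).toFinset

lemma S2.mem_PF {F : Type*} [Field F] [Fintype F] {n : ℕ} {l : Polynomial F} :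
    l ∈ S2.PF F n ↔ l.Monic ∧ Irreducible l ∧ l.natDegree ≤ n := by
  simp [S2.PF]

lemma S2.card_filter {F : Type*} [Field F] [Fintype F] (s : Finset (Polynomial F)) (r : ℕ)
    (hs : ∀ l : Polynomial F, l ∈ s ∧ l.natDegree = r ↔ l.Monic ∧ Irreducible l ∧ l.natDegree = r) :
    (s.filter (fun l => l.natDegree = r)).card = piq F r := by
  classical
  unfold piq
  rw [← Nat.card_eq_finsetCard]
  exact Nat.card_congr (Equiv.subtypeEquivRight (fun l => by simpa using hs l))

lemma S2.sum_PF {F : Type*} [Field F] [Fintype F] (n : ℕ) (f : ℕ → ℝ) :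
    ∑ l ∈ S2.PF F n, f l.natDegree = ∑ r ∈ Finset.range (n + 1), (piq F r : ℝ) * f r := by
  classical
  rw [← Finset.sum_fiberwise_of_maps_to (t := Finset.range (n + 1)) (g := fun l => l.natDegree)]
  · refine Finset.sum_congr rfl fun r hr => ?_
    rw [Finset.sum_congr rfl (g := fun _ => f r)]
    · rw [Finset.sum_const, nsmul_eq_mul, S2.card_filter]
      intro l
      rw [S2.mem_PF]
      have := Finset.mem_range.1 hr
      constructor
      · rintro ⟨⟨a, b, c⟩, d⟩; exact ⟨a, b, d⟩
      · rintro ⟨a, b, d⟩; exact ⟨⟨a, b, by omega⟩, d⟩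
    · intro l hl
      rw [(Finset.mem_filter.1 hl).2]
  · intro l hl
    have := (S2.mem_PF.1 hl).2.2
    simp; omega

lemma S2.gauss (F : Type*) [Field F] [Fintype F] (n : ℕ) (hn : n ≠ 0) :
    ∑ d ∈ n.divisors, d * piq F d = Fintype.card F ^ n := by
  classical
  set q := Fintype.card F with hq
  have hq1 : 1 < q := Fintype.one_lt_card
  set f : Polynomial F := X ^ q ^ n - X with hf
  have hf0 : f ≠ 0 := FiniteField.X_pow_card_pow_sub_X_ne_zero F hn hq1
  have hdeg : f.natDegree = q ^ n := FiniteField.X_pow_card_pow_sub_X_natDegree_eq F hn hq1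
  have hmon : f.Monic := by
    apply Polynomial.monic_X_pow_sub
    rw [Polynomial.degree_X]
    exact_mod_cast Nat.one_lt_pow hn hq1
  obtain ⟨p, hp⟩ := CharP.exists F
  have hpq : p ∣ q := by
    rw [← CharP.cast_eq_zero_iff F p, hq]; exact FiniteField.cast_card_eq_zero F
  have hsq : Squarefree f := (galois_poly_separable p _ (dvd_pow hpq hn)).squarefree
  have hnodup := (UniqueFactorizationMonoid.squarefree_iff_nodup_normalizedFactors hf0).1 hsq
  have hmem : ∀ l, l ∈ UniqueFactorizationMonoid.normalizedFactors f ↔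
      l.Monic ∧ Irreducible l ∧ l.natDegree ∣ n := by
    intro l
    rw [Polynomial.mem_normalizedFactors_iff hf0]
    constructor
    · rintro ⟨a, b, c⟩
      refine ⟨b, a, ?_⟩
      rw [a.natDegree_dvd_iff_dvd_X_pow_card_pow_sub_X, Nat.card_eq_fintype_card]
      exact c
    · rintro ⟨b, a, c⟩
      rw [a.natDegree_dvd_iff_dvd_X_pow_card_pow_sub_X, Nat.card_eq_fintype_card] at c
      exact ⟨a, b, c⟩
  have hprod := UniqueFactorizationMonoid.prod_normalizedFactors_eq hf0
  rw [hmon.normalize_eq_self] at hprod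
  have h1 := congrArg Polynomial.natDegree hprod
  rw [Polynomial.natDegree_multiset_prod_of_monic _ (fun l hl => ((hmem l).1 hl).1), hdeg] at h1
  rw [← h1]
  set T := (UniqueFactorizationMonoid.normalizedFactors f).toFinset with hT
  have h2 : (Multiset.map natDegree (UniqueFactorizationMonoid.normalizedFactors f)).sum
      = ∑ l ∈ T, l.natDegree := by
    rw [Finset.sum, hT, Multiset.toFinset_val, hnodup.dedup]
  rw [h2, ← Finset.sum_fiberwise_of_maps_to (s := T) (t := n.divisors) (g := fun l => l.natDegree)]
  · refine Finset.sum_congr rfl fun r hr => ?_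
    rw [Finset.sum_congr rfl (g := fun _ => r)]
    · rw [Finset.sum_const, smul_eq_mul, S2.card_filter, mul_comm]
      intro l
      rw [hT, Multiset.mem_toFinset, hmem]
      have := Nat.dvd_of_mem_divisors hr
      constructor
      · rintro ⟨⟨a, b, c⟩, d⟩; exact ⟨a, b, d⟩
      · rintro ⟨a, b, d⟩; exact ⟨⟨a, b, d ▸ this⟩, d⟩
    · intro l hl
      rw [(Finset.mem_filter.1 hl).2]
  · intro l hl
    rw [hT, Multiset.mem_toFinset, hmem] at hl
    exact Nat.mem_divisors.2 ⟨hl.2.2, hn⟩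

lemma S2.upper (F : Type*) [Field F] [Fintype F] (n : ℕ) :
    n * piq F n ≤ Fintype.card F ^ n := by
  rcases eq_or_ne n 0 with rfl | hn
  · simp
  rw [← S2.gauss F n hn]
  exact Finset.single_le_sum (f := fun d => d * piq F d) (fun _ _ => Nat.zero_le _)
    (Nat.mem_divisors_self n hn)

lemma S2.lower (F : Type*) [Field F] [Fintype F] (n : ℕ) :
    Fintype.card F ^ n ≤ n * piq F n + 2 * Fintype.card F ^ (n / 2) := by
  have hq1 : 1 < Fintype.card F := Fintype.one_lt_card
  rcases eq_or_ne n 0 with rfl | hn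
  · simp
  have h := S2.gauss F n hn
  rw [← Nat.cons_self_properDivisors hn, Finset.sum_cons] at h
  have h2 : ∑ d ∈ n.properDivisors, d * piq F d ≤ ∑ d ∈ Finset.range (n / 2 + 1), Fintype.card F ^ d := by
    refine (Finset.sum_le_sum fun d _ => S2.upper F d).trans ?_
    refine Finset.sum_le_sum_of_subset fun d hd => ?_
    rw [Nat.mem_properDivisors] at hd
    obtain ⟨⟨k, hk⟩, hlt⟩ := hd
    have : 2 ≤ k := by
      by_contra hk2
      have : k = 0 ∨ k = 1 := by omega
      rcases this with rfl | rfl <;> simp at hk <;> omega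
    simp only [Finset.mem_range]
    have : d * 2 ≤ d * k := Nat.mul_le_mul_left _ this
    omega
  have h3 : ∀ m, ∑ d ∈ Finset.range (m + 1), Fintype.card F ^ d ≤ 2 * Fintype.card F ^ m := by
    intro m
    induction m with
    | zero => simp
    | succ m ih =>
      rw [Finset.sum_range_succ, pow_succ]
      have : Fintype.card F ^ m * 2 ≤ Fintype.card F ^ m * Fintype.card F :=
        Nat.mul_le_mul_left _ hq1
      omega
  have := h3 (n / 2)
  omega

/-- the r-th error term -/
noncomputable def S2.E (F : Type*) [Field F] [Fintype F] (r : ℕ) : ℝ :=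
  if r = 0 then 0 else
      ((piq F r : ℝ) - (Fintype.card F : ℝ) ^ r / r) * ((Fintype.card F : ℝ) ^ r)⁻¹

/-- Mertens sum -/
noncomputable def S2.M (F : Type*) [Field F] [Fintype F] (m : ℕ) : ℝ :=
  ∑ l ∈ S2.PF F m, ((Fintype.card F : ℝ) ^ l.natDegree)⁻¹

lemma S2.two_le (F : Type*) [Field F] [Fintype F] : (2 : ℝ) ≤ Fintype.card F := by
  exact_mod_cast (Fintype.one_lt_card : 1 < Fintype.card F)

lemma S2.piq_zero (F : Type*) [Field F] [Fintype F] : piq F 0 = 0 := by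
  unfold piq
  have : IsEmpty {l : Polynomial F // l.Monic ∧ Irreducible l ∧ l.natDegree = 0} := by
    refine ⟨fun ⟨l, h1, h2, h3⟩ => ?_⟩
    have := h2.natDegree_pos
    omega
  simp

lemma S2.M_zero (F : Type*) [Field F] [Fintype F] : S2.M F 0 = 0 := by
  unfold S2.M
  apply Finset.sum_eq_zero
  intro l hl
  have h := S2.mem_PF.1 hl
  have := h.2.1.natDegree_pos
  omega

lemma S2.E_bound (F : Type*) [Field F] [Fintype F] (r : ℕ) :
    |S2.E F r| ≤ 2 * ((√2)⁻¹) ^ r := by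
  unfold S2.E
  split_ifs with h
  · simp
  have hq := S2.two_le F
  set q : ℝ := (Fintype.card F : ℝ) with hqd
  have hu : (r : ℝ) * piq F r ≤ q ^ r := by rw [hqd]; exact_mod_cast S2.upper F r
  have hl : q ^ r ≤ (r : ℝ) * piq F r + 2 * q ^ (r / 2) := by
    rw [hqd]; exact_mod_cast S2.lower F r
  have hr1 : (1 : ℝ) ≤ r := by exact_mod_cast Nat.one_le_iff_ne_zero.2 h
  have hr0 : (0 : ℝ) < r := by linarith
  have hqp : 0 < q ^ r := by positivity
  have e1 : |(piq F r : ℝ) - q ^ r / r| ≤ 2 * q ^ (r / 2) := by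
    have : (piq F r : ℝ) - q ^ r / r = (r * piq F r - q ^ r) / r := by field_simp
    rw [this, abs_div, abs_of_pos hr0, div_le_iff₀ hr0, abs_le]
    have hp : 0 ≤ q ^ (r / 2) := by positivity
    constructor <;> nlinarith
  rw [abs_mul, abs_of_pos (inv_pos.2 hqp)]
  calc _ ≤ 2 * q ^ (r / 2) * (q ^ r)⁻¹ := by gcongr
    _ = 2 * (q ^ (r - r / 2))⁻¹ := by
      have : q ^ r = q ^ (r / 2) * q ^ (r - r / 2) := by rw [← pow_add]; congr 1; omega
      have h0 : q ^ (r / 2) ≠ 0 := by positivity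
      rw [this, mul_inv]; field_simp
    _ ≤ _ := by
      rw [inv_pow]
      gcongr
      calc (√2) ^ r ≤ (√2) ^ (2 * (r - r / 2)) := by
            apply pow_le_pow_right₀
            · rw [Real.one_le_sqrt]; norm_num
            · omega
        _ = 2 ^ (r - r / 2) := by rw [pow_mul, Real.sq_sqrt (by norm_num)]
        _ ≤ _ := by gcongr

lemma S2.rho_lt : ‖(√2)⁻¹‖ < 1 := by
  rw [Real.norm_of_nonneg (by positivity)]
  apply inv_lt_one_of_one_lt₀
  rw [Real.lt_sqrt (by norm_num)]; norm_num

lemma S2.E_summable (F : Type*) [Field F] [Fintype F] : Summable (S2.E F) := by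
  refine Summable.of_norm_bounded (g := fun r => 2 * ((√2)⁻¹) ^ r) ?_ (S2.E_bound F)
  exact (summable_geometric_of_norm_lt_one S2.rho_lt).mul_left 2

lemma S2.rE_summable (F : Type*) [Field F] [Fintype F] :
    Summable (fun r : ℕ => (r : ℝ) * |S2.E F r|) := by
  have h := (summable_pow_mul_geometric_of_norm_lt_one 1 S2.rho_lt).mul_left 2
  refine Summable.of_nonneg_of_le (fun r => by positivity) (fun r => ?_) h
  have := mul_le_mul_of_nonneg_left (S2.E_bound F r) (Nat.cast_nonneg (α := ℝ) r)
  simp only [pow_one]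
  linarith

lemma S2.E_tail (F : Type*) [Field F] [Fintype F] (m : ℕ) (hm : 1 ≤ m) :
    |∑ r ∈ Finset.range (m + 1), S2.E F r - ∑' r, S2.E F r| ≤
      (∑' r : ℕ, (r : ℝ) * |S2.E F r|) / m := by
  have hm0 : (0 : ℝ) < m := by exact_mod_cast hm
  have h1 : HasSum (fun r => if r ∈ Finset.range (m + 1) then S2.E F r else 0)
      (∑ r ∈ Finset.range (m + 1), S2.E F r) := by
    have := hasSum_sum_of_ne_finset_zero (L := SummationFilter.unconditional ℕ) (s := Finset.range (m + 1))
      (f := fun r => if r ∈ Finset.range (m + 1) then S2.E F r else 0)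
      (fun b hb => by simp only [if_neg hb])
    convert this using 1
    exact Finset.sum_congr rfl fun r hr => by rw [if_pos hr]
  have h2 := h1.sub (S2.E_summable F).hasSum
  rw [← h2.tsum_eq, ← Real.norm_eq_abs]
  refine tsum_of_norm_bounded ((S2.rE_summable F).hasSum.div_const (m : ℝ)) fun r => ?_
  split_ifs with hr
  · simp; positivity
  · simp only [Finset.mem_range, not_lt] at hr
    rw [zero_sub, norm_neg, Real.norm_eq_abs, le_div_iff₀ hm0, mul_comm]
    have : (m : ℝ) ≤ r := by exact_mod_cast (by omega : m ≤ r)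
    gcongr

lemma S2.M_eq (F : Type*) [Field F] [Fintype F] (m : ℕ) :
    S2.M F m = ∑ r ∈ Finset.range (m + 1), S2.E F r + (harmonic m : ℝ) := by
  have hq := S2.two_le F
  unfold S2.M
  rw [S2.sum_PF m (fun r => ((Fintype.card F : ℝ) ^ r)⁻¹)]
  have : (harmonic m : ℝ) = ∑ r ∈ Finset.range (m + 1), ((r : ℝ))⁻¹ := by
    rw [Finset.sum_range_succ']
    simp [harmonic]
  rw [this, ← Finset.sum_add_distrib]
  refine Finset.sum_congr rfl fun r _ => ?_
  unfold S2.E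
  split_ifs with h
  · subst h; simp [S2.piq_zero]
  · have h1 : (r : ℝ) ≠ 0 := by exact_mod_cast h
    have h2 : (Fintype.card F : ℝ) ^ r ≠ 0 := by positivity
    field_simp
    ring

lemma S2.M_bound (F : Type*) [Field F] [Fintype F] :
    ∃ C : ℝ, 0 ≤ C ∧ ∀ m : ℕ, 1 ≤ m → |S2.M F m - Real.log m - A1 F| ≤ C / m := by
  refine ⟨(∑' r : ℕ, (r : ℝ) * |S2.E F r|) + 1, ?_, ?_⟩
  · have : 0 ≤ ∑' r : ℕ, (r : ℝ) * |S2.E F r| := tsum_nonneg fun r => by positivity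
    linarith
  intro m hm
  have hm0 : (0 : ℝ) < m := by exact_mod_cast hm
  have h1 := S2.E_tail F m hm
  have h2 := Real.eulerMascheroniSeq_lt_eulerMascheroniConstant m
  have h3 := Real.eulerMascheroniConstant_lt_eulerMascheroniSeq' m
  rw [Real.eulerMascheroniSeq] at h2
  rw [Real.eulerMascheroniSeq', if_neg (by omega)] at h3
  have h4 : Real.log (m + 1) - Real.log m ≤ 1 / m := by
    rw [← Real.log_div (by positivity) (by positivity)]
    refine (Real.log_le_sub_one_of_pos (by positivity)).trans (le_of_eq ?_)
    field_simp; ring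
  have hA : A1 F = Real.eulerMascheroniConstant + ∑' r, S2.E F r := rfl
  rw [S2.M_eq, hA, add_div]
  rw [abs_le] at h1 ⊢
  constructor
  · have : (0 : ℝ) ≤ 1 / m := by positivity
    linarith [h1.1]
  · linarith [h1.2]

lemma S2.M_bound2 (F : Type*) [Field F] [Fintype F] :
    ∃ K : ℝ, 0 ≤ K ∧ ∀ n : ℕ, 1 ≤ n → ∀ a : ℕ,
      |S2.M F (n - 2 * a) - Real.log n - A1 F| ≤ K * (1 + 2 * (a : ℝ)) ^ 2 / n := by
  obtain ⟨C, hC, h⟩ := S2.M_bound F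
  refine ⟨C + 1 + |A1 F|, by positivity, fun n hn a => ?_⟩
  have hn0 : (1 : ℝ) ≤ n := by exact_mod_cast hn
  have ha0 : (0 : ℝ) ≤ a := Nat.cast_nonneg a
  have hA := abs_nonneg (A1 F)
  have hn00 : (0 : ℝ) < n := by linarith
  by_cases hc : n ≤ 2 * a
  · rw [Nat.sub_eq_zero_of_le hc, S2.M_zero]
    have hc' : (n : ℝ) ≤ 2 * a := by exact_mod_cast hc
    have hlog0 := Real.log_nonneg hn0
    have hlog := Real.log_le_self hn00.le
    have : |0 - Real.log n - A1 F| ≤ n + |A1 F| := by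
      rw [abs_le]; constructor <;> linarith [neg_abs_le (A1 F), le_abs_self (A1 F)]
    refine this.trans ?_
    rw [le_div_iff₀ hn00]
    calc (n + |A1 F|) * n ≤ (2 * a + |A1 F|) * (2 * a) := by gcongr
      _ ≤ _ := by nlinarith [mul_nonneg hA ha0, mul_nonneg hC ha0, mul_nonneg (mul_nonneg hA ha0) ha0, mul_nonneg (mul_nonneg hC ha0) ha0]
  · obtain ⟨m, rfl⟩ : ∃ m, n = m + 2 * a := ⟨n - 2 * a, by omega⟩
    have hm : 1 ≤ m := by omega
    have hm1 : (1 : ℝ) ≤ m := by exact_mod_cast hm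
    have hm0 : (0 : ℝ) < m := by linarith
    rw [Nat.add_sub_cancel]
    have h1 := h m hm
    push_cast at *
    have h4 : Real.log (m + 2 * a) - Real.log m ≤ 2 * a / m := by
      rw [← Real.log_div (by positivity) (by positivity)]
      refine (Real.log_le_sub_one_of_pos (by positivity)).trans (le_of_eq ?_)
      field_simp; ring
    have h5 : Real.log m ≤ Real.log (m + 2 * a) := Real.log_le_log hm0 (by linarith)
    have h6 : |S2.M F m - Real.log (m + 2 * a) - A1 F| ≤ (C + 2 * a) / m := by
      rw [add_div]
      rw [abs_le] at h1 ⊢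
      have : 0 ≤ 2 * (a : ℝ) / m := by positivity
      constructor <;> linarith [h1.1, h1.2]
    refine h6.trans ?_
    rw [div_le_div_iff₀ hm0 hn00]
    calc (C + 2 * a) * (m + 2 * a) ≤ (C + 2 * a) * ((1 + 2 * a) * m) := by
          gcongr; nlinarith
      _ ≤ ((C + 1) * (1 + 2 * a)) * ((1 + 2 * a) * m) := by
          gcongr; nlinarith
      _ = (C + 1) * (1 + 2 * (a : ℝ)) ^ 2 * m := by ring
      _ ≤ _ := mul_le_mul_of_nonneg_right
          (mul_le_mul_of_nonneg_right (by linarith) (by positivity)) hm0.le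

lemma S2.summable_deg (F : Type*) [Field F] [Fintype F] (f : ℕ → ℝ) (hf : ∀ r, 0 ≤ f r)
    (hs : Summable fun r => (piq F r : ℝ) * f r) :
    Summable (fun l : {l : Polynomial F // l.Monic ∧ Irreducible l} =>
      f (l : Polynomial F).natDegree) := by
  classical
  refine summable_of_sum_le (c := ∑' r, (piq F r : ℝ) * f r) (fun l => hf _) fun u => ?_
  set N := u.sup (fun l => (l : Polynomial F).natDegree) with hN
  calc ∑ l ∈ u, f (l : Polynomial F).natDegree
      = ∑ l ∈ u.map (Function.Embedding.subtype _), f l.natDegree := by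
        rw [Finset.sum_map]; rfl
    _ ≤ ∑ l ∈ S2.PF F N, f l.natDegree := by
        refine Finset.sum_le_sum_of_subset_of_nonneg ?_ (fun _ _ _ => hf _)
        intro l hl
        rw [Finset.mem_map] at hl
        obtain ⟨x, hx, rfl⟩ := hl
        exact S2.mem_PF.2 ⟨x.2.1, x.2.2, Finset.le_sup (f := fun l : {l : Polynomial F // l.Monic ∧ Irreducible l} => (l : Polynomial F).natDegree) hx⟩
    _ = ∑ r ∈ Finset.range (N + 1), (piq F r : ℝ) * f r := S2.sum_PF N f
    _ ≤ _ := hs.sum_le_tsum _ (fun r _ => mul_nonneg (Nat.cast_nonneg _) (hf r))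

lemma S2.summable_main (F : Type*) [Field F] [Fintype F] :
    Summable (fun l : {l : Polynomial F // l.Monic ∧ Irreducible l} =>
      (((Fintype.card F : ℝ) ^ (l : Polynomial F).natDegree) ^ 2)⁻¹ *
        (1 + 2 * ((l : Polynomial F).natDegree : ℝ)) ^ 2) := by
  have hq := S2.two_le F
  refine S2.summable_deg F
    (fun r => (((Fintype.card F : ℝ) ^ r) ^ 2)⁻¹ * (1 + 2 * (r : ℝ)) ^ 2)
    (fun r => by positivity) ?_
  have hh : ‖(1 / 2 : ℝ)‖ < 1 := by norm_num
  have h0 := summable_pow_mul_geometric_of_norm_lt_one 0 hh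
  have h1 := (summable_pow_mul_geometric_of_norm_lt_one 1 hh).mul_left 4
  have h2 := (summable_pow_mul_geometric_of_norm_lt_one 2 hh).mul_left 4
  refine Summable.of_nonneg_of_le (fun r => by positivity) (fun r => ?_) ((h0.add h1).add h2)
  have hp : (piq F r : ℝ) ≤ (Fintype.card F : ℝ) ^ r := by
    rcases Nat.eq_zero_or_pos r with rfl | hr
    · simp [S2.piq_zero]
    · exact_mod_cast (Nat.le_mul_of_pos_left _ hr).trans (S2.upper F r)
  have hqr : (0 : ℝ) < (Fintype.card F : ℝ) ^ r := by positivity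
  calc (piq F r : ℝ) * ((((Fintype.card F : ℝ) ^ r) ^ 2)⁻¹ * (1 + 2 * (r : ℝ)) ^ 2)
      ≤ (Fintype.card F : ℝ) ^ r * ((((Fintype.card F : ℝ) ^ r) ^ 2)⁻¹ * (1 + 2 * (r : ℝ)) ^ 2) := by
        gcongr
    _ = ((Fintype.card F : ℝ) ^ r)⁻¹ * (1 + 2 * (r : ℝ)) ^ 2 := by field_simp
    _ ≤ ((2 : ℝ) ^ r)⁻¹ * (1 + 2 * (r : ℝ)) ^ 2 := by gcongr
    _ = _ := by rw [one_div, inv_pow]; ring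

lemma S2.inner (F : Type*) [Field F] [Fintype F] [DecidableEq (Polynomial F)] (n : ℕ)
    (l : Polynomial F) (hl : l.Monic ∧ Irreducible l) :
    ∑ h ∈ (S2.PF F (n - 2 * l.natDegree)).erase l, ((Fintype.card F : ℝ) ^ h.natDegree)⁻¹ =
      S2.M F (n - 2 * l.natDegree) -
        if 3 * l.natDegree ≤ n then ((Fintype.card F : ℝ) ^ l.natDegree)⁻¹ else 0 := by
  have hpos := hl.2.natDegree_pos
  unfold S2.M
  split_ifs with h
  · rw [Finset.sum_erase_eq_sub]
    exact S2.mem_PF.2 ⟨hl.1, hl.2, by omega⟩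
  · rw [Finset.erase_eq_of_notMem, sub_zero]
    intro hm
    have := (S2.mem_PF.1 hm).2.2
    omega

lemma S2.finsum_eq (F : Type*) [Field F] [Fintype F] (n : ℕ) :
    (∑ᶠ p ∈ {p : Polynomial F × Polynomial F |
            p.1.Monic ∧ Irreducible p.1 ∧ p.2.Monic ∧ Irreducible p.2 ∧ p.1 ≠ p.2 ∧
            2 * p.1.natDegree + p.2.natDegree ≤ n},
          (((Fintype.card F : ℝ) ^ p.1.natDegree) ^ 2)⁻¹ *
            ((Fintype.card F : ℝ) ^ p.2.natDegree)⁻¹) =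
    ∑ l ∈ S2.PF F n, (((Fintype.card F : ℝ) ^ l.natDegree) ^ 2)⁻¹ *
      (S2.M F (n - 2 * l.natDegree) -
        if 3 * l.natDegree ≤ n then ((Fintype.card F : ℝ) ^ l.natDegree)⁻¹ else 0) := by
  classical
  have hset : {p : Polynomial F × Polynomial F |
            p.1.Monic ∧ Irreducible p.1 ∧ p.2.Monic ∧ Irreducible p.2 ∧ p.1 ≠ p.2 ∧
            2 * p.1.natDegree + p.2.natDegree ≤ n} =
      (((S2.PF F n) ×ˢ (S2.PF F n)).filter (fun p => p.1 ≠ p.2 ∧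
            2 * p.1.natDegree + p.2.natDegree ≤ n) : Finset _) := by
    ext p
    simp only [Set.mem_ofPred_eq, Finset.coe_filter, Finset.mem_product, S2.mem_PF]
    constructor
    · rintro ⟨a, b, c, d, e, f⟩
      exact ⟨⟨⟨a, b, by omega⟩, c, d, by omega⟩, e, f⟩
    · rintro ⟨⟨⟨a, b, _⟩, c, d, _⟩, e, f⟩
      exact ⟨a, b, c, d, e, f⟩
  rw [hset, finsum_mem_coe_finset, Finset.sum_filter, Finset.sum_product]
  refine Finset.sum_congr rfl fun l hl => ?_
  have hl' := S2.mem_PF.1 hl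
  rw [← S2.inner F n l ⟨hl'.1, hl'.2.1⟩, Finset.mul_sum, ← Finset.sum_filter]
  refine Finset.sum_congr ?_ fun _ _ => rfl
  ext h
  simp only [Finset.mem_filter, Finset.mem_erase, S2.mem_PF]
  constructor
  · rintro ⟨⟨a, b, _⟩, e, f⟩
    exact ⟨Ne.symm e, a, b, by omega⟩
  · rintro ⟨e, a, b, c⟩
    have := b.natDegree_pos
    exact ⟨⟨a, b, by omega⟩, Ne.symm e, by omega⟩

lemma S2.hasSum_S (F : Type*) [Field F] [Fintype F] (n : ℕ) :
    HasSum (fun l : {l : Polynomial F // l.Monic ∧ Irreducible l} =>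
      (((Fintype.card F : ℝ) ^ (l : Polynomial F).natDegree) ^ 2)⁻¹ *
      (S2.M F (n - 2 * (l : Polynomial F).natDegree) -
        if 3 * (l : Polynomial F).natDegree ≤ n then
          ((Fintype.card F : ℝ) ^ (l : Polynomial F).natDegree)⁻¹ else 0))
    (∑ᶠ p ∈ {p : Polynomial F × Polynomial F |
            p.1.Monic ∧ Irreducible p.1 ∧ p.2.Monic ∧ Irreducible p.2 ∧ p.1 ≠ p.2 ∧
            2 * p.1.natDegree + p.2.natDegree ≤ n},
          (((Fintype.card F : ℝ) ^ p.1.natDegree) ^ 2)⁻¹ *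
            ((Fintype.card F : ℝ) ^ p.2.natDegree)⁻¹) := by
  classical
  rw [S2.finsum_eq, ← Finset.sum_subtype_of_mem (p := fun l : Polynomial F => l.Monic ∧ Irreducible l)
    (fun l : Polynomial F => (((Fintype.card F : ℝ) ^ l.natDegree) ^ 2)⁻¹ *
      (S2.M F (n - 2 * l.natDegree) -
        if 3 * l.natDegree ≤ n then ((Fintype.card F : ℝ) ^ l.natDegree)⁻¹ else 0))
    (fun l hl => ⟨(S2.mem_PF.1 hl).1, (S2.mem_PF.1 hl).2.1⟩)]
  refine hasSum_sum_of_ne_finset_zero fun l hl => ?_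
  rw [Finset.mem_subtype, S2.mem_PF] at hl
  have hd : ¬ (l : Polynomial F).natDegree ≤ n := fun h => hl ⟨l.2.1, l.2.2, h⟩
  rw [Nat.sub_eq_zero_of_le (by omega), S2.M_zero, if_neg (by omega)]
  simp

/-- S₂(n): sum over distinct monic irreducibles l ≠ h with deg(l²h) ≤ n of 1/(|l|²|h|). -/
theorem S2_asymptotic (F : Type*) [Field F] [Fintype F] :
    (fun n : ℕ =>
        (∑ᶠ p ∈ {p : Polynomial F × Polynomial F |
            p.1.Monic ∧ Irreducible p.1 ∧ p.2.Monic ∧ Irreducible p.2 ∧ p.1 ≠ p.2 ∧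
            2 * p.1.natDegree + p.2.natDegree ≤ n},
          (((Fintype.card F : ℝ) ^ p.1.natDegree) ^ 2)⁻¹ *
            ((Fintype.card F : ℝ) ^ p.2.natDegree)⁻¹) -
          (Lc F 2 * Real.log n + A1 F * Lc F 2 - Lc F 3))
      =O[atTop] (fun n : ℕ => 1 / (n : ℝ)) := by
  have hq := S2.two_le F
  obtain ⟨K, hK, hM⟩ := S2.M_bound2 F
  have hsum := S2.summable_main F
  have hL2 : Summable (fun l : {l : Polynomial F // l.Monic ∧ Irreducible l} =>
      (((Fintype.card F : ℝ) ^ (l : Polynomial F).natDegree) ^ 2)⁻¹) := by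
    refine Summable.of_nonneg_of_le (fun l => by positivity) (fun l => ?_) hsum
    refine le_mul_of_one_le_right (by positivity) ?_
    have : (0 : ℝ) ≤ (l : Polynomial F).natDegree := Nat.cast_nonneg _
    nlinarith
  have hle : ∀ r : ℕ, (((Fintype.card F : ℝ) ^ r) ^ 3)⁻¹ ≤ (((Fintype.card F : ℝ) ^ r) ^ 2)⁻¹ := by
    intro r
    have : (1 : ℝ) ≤ (Fintype.card F : ℝ) ^ r := one_le_pow₀ (by linarith)
    gcongr
    norm_num
  have hL3 : Summable (fun l : {l : Polynomial F // l.Monic ∧ Irreducible l} =>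
      (((Fintype.card F : ℝ) ^ (l : Polynomial F).natDegree) ^ 3)⁻¹) :=
    Summable.of_nonneg_of_le (fun l => by positivity) (fun l => hle _) hL2
  refine IsBigO.of_bound ((K + 3) * ∑' l : {l : Polynomial F // l.Monic ∧ Irreducible l},
      (((Fintype.card F : ℝ) ^ (l : Polynomial F).natDegree) ^ 2)⁻¹ *
        (1 + 2 * ((l : Polynomial F).natDegree : ℝ)) ^ 2) ?_
  refine (eventually_ge_atTop 1).mono fun n hn => ?_
  have hn0 : (0 : ℝ) < n := by exact_mod_cast hn
  have hS := (S2.hasSum_S F n).sub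
    (((hL2.hasSum.mul_right (Real.log n)).add (hL2.hasSum.mul_left (A1 F))).sub hL3.hasSum)
  unfold Lc
  rw [← hS.tsum_eq, Real.norm_of_nonneg (by positivity : (0 : ℝ) ≤ 1 / n), mul_one_div]
  refine tsum_of_norm_bounded ((hsum.hasSum.mul_left (K + 3)).div_const (n : ℝ)) fun l => ?_
  set d := (l : Polynomial F).natDegree with hd
  set x := (Fintype.card F : ℝ) ^ d with hx
  have hx0 : 0 < x := by positivity
  have h1 := hM n hn d
  have hd0 : (0 : ℝ) ≤ d := Nat.cast_nonneg _
  have h3 : |(x ^ 3)⁻¹ - (x ^ 2)⁻¹ * (if 3 * d ≤ n then x⁻¹ else 0)| ≤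
      3 * ((x ^ 2)⁻¹ * (1 + 2 * (d : ℝ)) ^ 2 / n) := by
    split_ifs with hc
    · have : (x ^ 3)⁻¹ - (x ^ 2)⁻¹ * x⁻¹ = 0 := by field_simp; ring
      rw [this, abs_zero]; positivity
    · rw [mul_zero, sub_zero, abs_of_pos (by positivity)]
      refine (hle d).trans ?_
      have hc' : (n : ℝ) ≤ 3 * d := by exact_mod_cast (by omega : n ≤ 3 * d)
      rw [← mul_div_assoc, le_div_iff₀ hn0]
      calc (x ^ 2)⁻¹ * n ≤ (x ^ 2)⁻¹ * (3 * (1 + 2 * (d : ℝ)) ^ 2) := by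
            gcongr; nlinarith
        _ = _ := by ring
  have h2 : |(x ^ 2)⁻¹ * (S2.M F (n - 2 * d) - Real.log n - A1 F)| ≤
      K * ((x ^ 2)⁻¹ * (1 + 2 * (d : ℝ)) ^ 2 / n) := by
    rw [abs_mul, abs_of_pos (by positivity : 0 < (x ^ 2)⁻¹)]
    calc _ ≤ (x ^ 2)⁻¹ * (K * (1 + 2 * (d : ℝ)) ^ 2 / n) := by gcongr
      _ = _ := by ring
  rw [Real.norm_eq_abs]
  calc _ = |(x ^ 2)⁻¹ * (S2.M F (n - 2 * d) - Real.log n - A1 F) +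
        ((x ^ 3)⁻¹ - (x ^ 2)⁻¹ * (if 3 * d ≤ n then x⁻¹ else 0))| := by
        congr 1; ring
    _ ≤ _ := abs_add_le _ _
    _ ≤ _ := add_le_add h2 h3
    _ = _ := by ring
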